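/- None of the simple groups A₅, A₆, A₇, PSL(3,2) has a generating subset S with |S| = 7, S = S⁻¹, 1 ∉ S, such that S is a union of conjugacy classes. -/

import Mathlib

/-- The conjugation action of `K` on a conjugation-invariant finset. -/
def conjAct7 {K : Type*} [Group K] (U : Finset K) (hU : ∀ g : K, ∀ s ∈ U, g * s * g⁻¹ ∈ U) :
    MulAction K U where
  smul g s := ⟨g * s.1 * g⁻¹, hU g s.1 s.2⟩
  one_smul s := by
    apply Subtype.ext
    change 1 * s.1 * 1⁻¹ = s.1
    simp
  mul_smul g h s := by
    apply Subtype.ext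
    change (g * h) * s.1 * (g * h)⁻¹ = g * (h * s.1 * h⁻¹) * g⁻¹
    group

/-- The permutation representation on a conjugation-invariant finset. -/
def conjHom7 {K : Type*} [Group K] (U : Finset K) (hU : ∀ g : K, ∀ s ∈ U, g * s * g⁻¹ ∈ U) :
    K →* Equiv.Perm U :=
  @MulAction.toPermHom K U _ (conjAct7 U hU)

theorem conjHom7_apply {K : Type*} [Group K] (U : Finset K)
    (hU : ∀ g : K, ∀ s ∈ U, g * s * g⁻¹ ∈ U) (g : K) (s : U) :
    (conjHom7 U hU g s : K) = g * s.1 * g⁻¹ := rfl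

theorem conjHom7_injective {K : Type*} [Group K] [Finite K] [IsSimpleGroup K]
    (hp : ¬ (Nat.card K).Prime) (U : Finset K) (hU : ∀ g : K, ∀ s ∈ U, g * s * g⁻¹ ∈ U)
    (h1 : (1 : K) ∉ U) (hne : U.Nonempty) : Function.Injective (conjHom7 U hU) := by
  rw [← MonoidHom.ker_eq_bot_iff]
  refine (MonoidHom.normal_ker (conjHom7 U hU)).eq_bot_or_eq_top.resolve_right fun htop => ?_
  obtain ⟨u, hu⟩ := hne
  have hcen : u ∈ Subgroup.center K := by
    rw [Subgroup.mem_center_iff]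
    intro g
    have hg : g ∈ (conjHom7 U hU).ker := htop ▸ Subgroup.mem_top g
    rw [MonoidHom.mem_ker] at hg
    have := conjHom7_apply U hU g ⟨u, hu⟩
    rw [hg] at this
    simp only [Equiv.Perm.coe_one, id] at this
    exact (eq_mul_inv_iff_mul_eq.1 this).symm
  have hc : Subgroup.center K = ⊤ := by
    refine (inferInstance : (Subgroup.center K).Normal).eq_bot_or_eq_top.resolve_left fun hb => ?_
    rw [hb, Subgroup.mem_bot] at hcen
    exact h1 (hcen ▸ hu)
  letI : CommGroup K := Group.commGroupOfCenterEqTop hc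
  exact hp (CommGroup.is_simple_iff_prime_card.1 ‹_›)

theorem five_le_card7 {K : Type*} [Group K] [Finite K] [IsSimpleGroup K]
    (hp : ¬ (Nat.card K).Prime) (h60 : 60 ≤ Nat.card K)
    (U : Finset K) (hU : ∀ g : K, ∀ s ∈ U, g * s * g⁻¹ ∈ U)
    (h1 : (1 : K) ∉ U) (hne : U.Nonempty) : 5 ≤ U.card := by
  by_contra! h
  have hi := Nat.card_le_card_of_injective _ (conjHom7_injective hp U hU h1 hne)
  rw [Nat.card_perm, Nat.card_eq_fintype_card (α := U), Fintype.card_coe] at hi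
  have : U.card.factorial ≤ Nat.factorial 4 := Nat.factorial_le (by omega)
  have h4 : Nat.factorial 4 = 24 := rfl
  omega

theorem no_seven7 {K : Type*} [Group K] [Finite K] [IsSimpleGroup K]
    (hp : ¬ (Nat.card K).Prime) (h60 : 60 ≤ Nat.card K)
    (S : Finset K) (h7 : S.card = 7) (h1 : (1 : K) ∉ S) (hinv : ∀ s ∈ S, s⁻¹ ∈ S)
    (hS : ∀ g : K, ∀ s ∈ S, g * s * g⁻¹ ∈ S) : False := by
  classical
  have hne : S.Nonempty := Finset.card_pos.1 (by omega)
  -- an involution in S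
  obtain ⟨a, ha⟩ : ∃ a : S, a.1 * a.1 = 1 := by
    let σ : Equiv.Perm S := ⟨fun s => ⟨s.1⁻¹, hinv _ s.2⟩, fun s => ⟨s.1⁻¹, hinv _ s.2⟩,
      fun s => by simp, fun s => by simp⟩
    have hσ : σ ^ 2 ^ 1 = 1 := by
      ext s
      simp [σ, pow_two]
    haveI : Fact (Nat.Prime 2) := ⟨Nat.prime_two⟩
    obtain ⟨a, ha⟩ := Equiv.Perm.exists_fixed_point_of_prime (p := 2)
      (by rw [Fintype.card_coe, h7]; decide) hσ
    refine ⟨a, ?_⟩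
    have h : a.1⁻¹ = a.1 := congrArg Subtype.val ha
    calc a.1 * a.1 = a.1⁻¹ * a.1 := by rw [h]
      _ = 1 := by simp
  -- all are involutions
  have hall : ∀ s ∈ S, s * s = 1 := by
    by_contra! hcon
    obtain ⟨b, hb, hb2⟩ := hcon
    have hconj : ∀ g s : K, g * s * g⁻¹ * (g * s * g⁻¹) = g * (s * s) * g⁻¹ := by
      intro g s; group
    have e1 := five_le_card7 hp h60 (S.filter fun s => s * s = 1)
      (by
        intro g s hs
        rw [Finset.mem_filter] at hs ⊢
        refine ⟨hS g s hs.1, ?_⟩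
        rw [hconj, hs.2]; simp)
      (by simp [h1]) ⟨a, by simp [ha]⟩
    have e2 := five_le_card7 hp h60 (S.filter fun s => ¬ s * s = 1)
      (by
        intro g s hs
        rw [Finset.mem_filter] at hs ⊢
        refine ⟨hS g s hs.1, ?_⟩
        rw [hconj, conj_eq_one_iff]; exact hs.2)
      (by simp) ⟨b, by simp [hb, hb2]⟩
    have e3 := Finset.card_filter_add_card_filter_not (s := S) (fun s => s * s = 1)
    omega
  have hinj := conjHom7_injective hp S hS h1 hne
  -- the action is even
  have heven : ∀ g, Equiv.Perm.sign (conjHom7 S hS g) = 1 := by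
    let f : K →* ℤˣ := Equiv.Perm.sign.comp (conjHom7 S hS)
    rcases (MonoidHom.normal_ker f).eq_bot_or_eq_top with h | h
    · have := Nat.card_le_card_of_injective _ ((MonoidHom.ker_eq_bot_iff f).1 h)
      rw [Nat.card_eq_fintype_card (α := ℤˣ), Fintype.card_units_int] at this
      omega
    · intro g
      have hg : g ∈ f.ker := h ▸ Subgroup.mem_top g
      exact hg
  -- commuting sets
  let C : K → Finset K := fun s => S.filter fun t => s * t * s⁻¹ = t
  have hC3 : ∀ s ∈ S, (C s).card = 3 := by
    intro s hs
    have hsq : (conjHom7 S hS s) ^ 2 = 1 := by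
      rw [← map_pow, pow_two, hall s hs, map_one]
    have hsg := Equiv.Perm.sign_of_pow_two_eq_one hsq
    rw [heven s, Fintype.card_coe, h7] at hsg
    have hcard : Fintype.card (Function.fixedPoints (conjHom7 S hS s)) = (C s).card := by
      rw [← Fintype.card_coe]
      refine Fintype.card_congr ⟨fun x => ⟨x.1.1, ?_⟩, fun x => ⟨⟨x.1, ?_⟩, ?_⟩, ?_, ?_⟩
      · exact Finset.mem_filter.2 ⟨x.1.2, congrArg Subtype.val x.2⟩
      · exact (Finset.mem_filter.1 x.2).1
      · exact Subtype.ext (Finset.mem_filter.1 x.2).2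
      · intro x; rfl
      · intro x; rfl
    have hmod := Equiv.Perm.card_fixedPoints (conjHom7 S hS s)
    have hne1 : conjHom7 S hS s ≠ 1 := by
      intro h
      rw [← map_one (conjHom7 S hS)] at h
      exact h1 (hinj h ▸ hs)
    have hord : orderOf (conjHom7 S hS s) = 2 := orderOf_eq_prime hsq hne1
    obtain ⟨n, hn⟩ := Equiv.Perm.cycleType_prime_order (σ := conjHom7 S hS s)
      (by rw [hord]; exact Nat.prime_two)
    have hle := Equiv.Perm.sum_cycleType_le (conjHom7 S hS s)
    rw [hn, hord, Multiset.sum_replicate, smul_eq_mul, Fintype.card_coe, h7] at hmod hle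
    rw [hmod] at hsg
    have hn3 : n < 3 := by omega
    interval_cases n
    · exact absurd hsg (by decide)
    · omega
    · exact absurd hsg (by decide)
  have hself : ∀ s ∈ S, s ∈ C s := fun s hs => Finset.mem_filter.2 ⟨hs, by simp⟩
  have hsymm : ∀ s ∈ S, ∀ t ∈ C s, s ∈ C t := by
    intro s hs t ht
    have := (Finset.mem_filter.1 ht).2
    refine Finset.mem_filter.2 ⟨hs, ?_⟩
    rw [mul_inv_eq_iff_eq_mul] at this ⊢
    exact this.symm
  have hCeq : ∀ s ∈ S, ∀ t ∈ C s, C t = C s := by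
    intro s hs t ht
    by_cases hst : t = s
    · rw [hst]
    have htS : t ∈ S := (Finset.mem_filter.1 ht).1
    have hcs : s * t * s⁻¹ = t := (Finset.mem_filter.1 ht).2
    refine Finset.eq_of_subset_of_card_le ?_ (by rw [hC3 s hs, hC3 t htS])
    intro c hc
    have hcS : c ∈ S := (Finset.mem_filter.1 hc).1
    have hct : t * c * t⁻¹ = c := (Finset.mem_filter.1 hc).2
    by_cases c1 : c = s
    · rw [c1]; exact hself s hs
    by_cases c2 : c = t
    · rw [c2]; exact ht
    by_contra hcn
    have hd : s * c * s⁻¹ ≠ c := fun h => hcn (Finset.mem_filter.2 ⟨hcS, h⟩)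
    have hdm : s * c * s⁻¹ ∈ C t := by
      refine Finset.mem_filter.2 ⟨hS s c hcS, ?_⟩
      have hcomm : t * s = s * t := (mul_inv_eq_iff_eq_mul.1 hcs).symm
      calc t * (s * c * s⁻¹) * t⁻¹ = (t * s) * c * (t * s)⁻¹ := by group
        _ = s * (t * c * t⁻¹) * s⁻¹ := by rw [hcomm]; group
        _ = s * c * s⁻¹ := by rw [hct]
    have d1 : s * c * s⁻¹ ≠ s := by
      intro h
      apply c1
      have : s * c = s * s := mul_inv_eq_iff_eq_mul.1 h
      exact mul_left_cancel this
    have d2 : s * c * s⁻¹ ≠ t := by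
      intro h
      apply c2
      rw [← hcs] at h
      exact mul_left_cancel (mul_right_cancel h)
    have hsub : ({s, t, c, s * c * s⁻¹} : Finset K) ⊆ C t := by
      intro x hx
      simp only [Finset.mem_insert, Finset.mem_singleton] at hx
      rcases hx with rfl | rfl | rfl | rfl
      · exact hsymm _ hs _ ht
      · exact hself _ htS
      · exact hc
      · exact hdm
    have h4 : ({s, t, c, s * c * s⁻¹} : Finset K).card = 4 := by
      rw [Finset.card_insert_of_notMem, Finset.card_insert_of_notMem,
        Finset.card_insert_of_notMem, Finset.card_singleton]
      · simpa using hd.symm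
      · simp only [Finset.mem_insert, Finset.mem_singleton, not_or]
        exact ⟨fun h => c2 h.symm, d2.symm⟩
      · simp only [Finset.mem_insert, Finset.mem_singleton, not_or]
        exact ⟨fun h => hst h.symm, fun h => c1 h.symm, d1.symm⟩
    have := Finset.card_le_card hsub
    rw [h4, hC3 t htS] at this
    omega
  have hcount := Finset.card_eq_sum_card_image C S
  have hfib : ∀ b ∈ S.image C, (S.filter fun a => C a = b).card = 3 := by
    intro b hb
    obtain ⟨s, hs, rfl⟩ := Finset.mem_image.1 hb
    rw [← hC3 s hs]
    congr 1
    ext t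
    constructor
    · intro h
      have h' := Finset.mem_filter.1 h
      exact h'.2 ▸ hself t h'.1
    · intro h
      exact Finset.mem_filter.2 ⟨(Finset.mem_filter.1 h).1, hCeq s hs t h⟩
  rw [Finset.sum_congr rfl hfib, Finset.sum_const, smul_eq_mul, h7] at hcount
  omega

theorem no_conjugation_invariant_generating_7_set {K : Type*} [Group K] [Finite K]
    (hK : Nonempty (K ≃* alternatingGroup (Fin 5)) ∨
          Nonempty (K ≃* alternatingGroup (Fin 6)) ∨
          Nonempty (K ≃* alternatingGroup (Fin 7)) ∨
          (IsSimpleGroup K ∧ Nat.card K = 168)) :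
    ¬ ∃ S : Finset K, S.card = 7 ∧ (1 : K) ∉ S ∧ (∀ s ∈ S, s⁻¹ ∈ S) ∧
        Subgroup.closure (S : Set K) = ⊤ ∧ ∀ g : K, ∀ s ∈ S, g * s * g⁻¹ ∈ S := by
  rintro ⟨S, h7, h1, hinv, -, hS⟩
  have key : IsSimpleGroup K ∧ (Nat.card K = 60 ∨ Nat.card K = 360 ∨ Nat.card K = 2520 ∨
      Nat.card K = 168) := by
    rcases hK with ⟨⟨e⟩⟩ | ⟨⟨e⟩⟩ | ⟨⟨e⟩⟩ | h
    · haveI := alternatingGroup.isSimpleGroup (α := Fin 5) (by simp)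
      refine ⟨e.isSimpleGroup, Or.inl ?_⟩
      rw [Nat.card_congr e.toEquiv, nat_card_alternatingGroup, Nat.card_fin]; rfl
    · haveI := alternatingGroup.isSimpleGroup (α := Fin 6) (by simp)
      refine ⟨e.isSimpleGroup, Or.inr (Or.inl ?_)⟩
      rw [Nat.card_congr e.toEquiv, nat_card_alternatingGroup, Nat.card_fin]; rfl
    · haveI := alternatingGroup.isSimpleGroup (α := Fin 7) (by simp)
      refine ⟨e.isSimpleGroup, Or.inr (Or.inr (Or.inl ?_))⟩
      rw [Nat.card_congr e.toEquiv, nat_card_alternatingGroup, Nat.card_fin]; rfl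
    · exact ⟨h.1, Or.inr (Or.inr (Or.inr h.2))⟩
  obtain ⟨hs, hc⟩ := key
  refine no_seven7 ?_ ?_ S h7 h1 hinv hS
  · rcases hc with h | h | h | h <;> rw [h] <;> norm_num
  · omega
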